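/- arXiv:1012.4162 — 4 statements merged into one kernel-verified Lean document; each statement's English description precedes it below -/
import Mathlib

section
/- In the c-free Fock model, let η₁, η₂ ∈ ℓ²(J) be unit vectors (not necessarily orthogonal), let a be a bounded operator on ℋ, and set x := π(a). Then A*_{η₁} ∘ x ∘ A*_{η₂} = ψ(x) · (A*_{η₁} ∘ A*_{η₂}) and, for every n ≥ 0, A_{η₁,n} ∘ x ∘ A*_{η₂} = ψ(x) · (A_{η₁,n} ∘ A*_{η₂}), where ψ(x) = ⟨aω, ω⟩. -/
noncomputable section
open scoped ComplexInnerProductSpace ENNReal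
open PowerSeries

/-- The Hilbert space `E = ℋ ⊕ ℓ²(List J; ℋ)` of the c-free Fock model. -/
abbrev FockE (H : Type*) [NormedAddCommGroup H] [InnerProductSpace ℂ H]
    (J : Type*) : Type _ :=
  WithLp 2 (H × lp (fun _ : List J => H) 2)

section FockModel

variable {H : Type*} [NormedAddCommGroup H] [InnerProductSpace ℂ H]
variable {J : Type*} [DecidableEq J]

/-- The first (ℋ-)component of an element of `E`. -/
def efst (ζ : FockE H J) : H := (WithLp.equiv 2 _ ζ).1

/-- The second component of an element of `E`, as an ℋ-valued function on words. -/
def esnd (ζ : FockE H J) (w : List J) : H :=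
  ((WithLp.equiv 2 _ ζ).2 : ∀ _ : List J, H) w

/-- The distinguished unit vector `Ω = (0, δ_[]·ω)` of `E`. -/
def fockOmega (J : Type*) [DecidableEq J] {H : Type*} [NormedAddCommGroup H]
    [InnerProductSpace ℂ H] (ω : H) : FockE H J :=
  (WithLp.equiv 2 _).symm (0, lp.single 2 ([] : List J) ω)

/-- The unit vector `e_ω = (ω, 0)` of `E`. -/
def fockEOmega (J : Type*) [DecidableEq J] {H : Type*} [NormedAddCommGroup H]
    [InnerProductSpace ℂ H] (ω : H) : FockE H J :=
  (WithLp.equiv 2 _).symm (ω, 0)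

/-- The state `φ(T) = ⟨TΩ, Ω⟩` (inner product ℂ-linear in the first argument, i.e.
`⟪Ω, TΩ⟫` in Mathlib's convention). -/
def fockPhi (J : Type*) [DecidableEq J] {H : Type*} [NormedAddCommGroup H]
    [InnerProductSpace ℂ H] (ω : H) (T : FockE H J →L[ℂ] FockE H J) : ℂ :=
  ⟪fockOmega J ω, T (fockOmega J ω)⟫

/-- The state `ψ(T) = ⟨T e_ω, e_ω⟩`. -/
def fockPsi (J : Type*) [DecidableEq J] {H : Type*} [NormedAddCommGroup H]
    [InnerProductSpace ℂ H] (ω : H) (T : FockE H J →L[ℂ] FockE H J) : ℂ :=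
  ⟪fockEOmega J ω, T (fockEOmega J ω)⟫

/-- `P` is the orthogonal projection `P_Ω` onto `ℂΩ`. -/
def IsProjOmega (ω : H) (P : FockE H J →L[ℂ] FockE H J) : Prop :=
  ∀ ζ : FockE H J, P ζ = ⟪fockOmega J ω, ζ⟫ • fockOmega J ω

/-- `x` is the image `π(a)` of a bounded operator `a` on ℋ under the embedding `π`:
`π(a)(h, F) = (a h', w ↦ a (F' w))` where `(h', F') = (h, F) − ⟨(h,F), Ω⟩·Ω`. -/
def IsEmbed (ω : H) (a : H →L[ℂ] H) (x : FockE H J →L[ℂ] FockE H J) : Prop :=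
  ∀ ζ : FockE H J,
    efst (x ζ) = a (efst (ζ - ⟪fockOmega J ω, ζ⟫ • fockOmega J ω)) ∧
    ∀ w : List J,
      esnd (x ζ) w = a (esnd (ζ - ⟪fockOmega J ω, ζ⟫ • fockOmega J ω) w)

/-- `T` is the creation-type operator `A*_η`: `A*_η(h, F) = (0, G)` with `G [] = 0` and
`G (j :: w) = η j · ⟨F w, ω⟩ · ω`. -/
def IsCre (ω : H) (η : lp (fun _ : J => ℂ) 2) (T : FockE H J →L[ℂ] FockE H J) : Prop :=
  ∀ ζ : FockE H J, efst (T ζ) = 0 ∧ esnd (T ζ) ([] : List J) = 0 ∧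
    ∀ (j : J) (w : List J), esnd (T ζ) (j :: w) = η j • (⟪ω, esnd ζ w⟫ • ω)

/-- `ξ` is the vector `ξ_{η,n} = (0, F_n)`, where `F_n w = η(w₁)⋯η(w_n)·ω` on words of
length `n` and `F_n w = 0` otherwise.  (For `n = 0` this is exactly `Ω`.) -/
def IsXi (ω : H) (η : lp (fun _ : J => ℂ) 2) (n : ℕ) (ξ : FockE H J) : Prop :=
  efst ξ = 0 ∧ ∀ w : List J,
    esnd ξ w = if w.length = n then (w.map fun j => η j).prod • ω else 0

/-- `T` is the annihilation-type operator `A_{η,n}`: the rank-one operator with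
`T ξ_{η,n} = Ω` and `T ζ = 0` for `ζ ⊥ ξ_{η,n}`, i.e. `T ζ = ⟨ζ, ξ_{η,n}⟩·Ω`.
For `n = 0` this is exactly the projection `P_Ω`, as required. -/
def IsAnn (ω : H) (η : lp (fun _ : J => ℂ) 2) (n : ℕ)
    (T : FockE H J →L[ℂ] FockE H J) : Prop :=
  ∃ ξ : FockE H J, IsXi ω η n ξ ∧ ∀ ζ : FockE H J, T ζ = ⟪ξ, ζ⟫ • fockOmega J ω

end FockModel

section Helpers

variable {H : Type*} [NormedAddCommGroup H] [InnerProductSpace ℂ H]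
variable {J : Type*} [DecidableEq J]

lemma fock_ext {ζ ζ' : FockE H J} (h1 : efst ζ = efst ζ') (h2 : ∀ w, esnd ζ w = esnd ζ' w) :
    ζ = ζ' := by
  apply (WithLp.equiv 2 _).injective
  exact Prod.ext h1 (lp.ext (funext h2))

lemma efst_smul (c : ℂ) (ζ : FockE H J) : efst (c • ζ) = c • efst ζ := rfl

lemma esnd_smul (c : ℂ) (ζ : FockE H J) (w : List J) : esnd (c • ζ) w = c • esnd ζ w := rfl

lemma fock_inner (ζ ζ' : FockE H J) :
    ⟪ζ, ζ'⟫ = ⟪efst ζ, efst ζ'⟫ + ∑' w, ⟪esnd ζ w, esnd ζ' w⟫ := by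
  rw [WithLp.prod_inner_apply, lp.inner_eq_tsum]
  rfl

lemma omega_inner (ω : H) (ζ : FockE H J) : ⟪fockOmega J ω, ζ⟫ = ⟪ω, esnd ζ []⟫ := by
  unfold fockOmega
  rw [WithLp.prod_inner_apply]
  simp [lp.inner_single_left, esnd]

lemma embed_cre (ω : H) (hω : ‖ω‖ = 1) (η : lp (fun _ : J => ℂ) 2)
    (a : H →L[ℂ] H) (x : FockE H J →L[ℂ] FockE H J) (hx : IsEmbed ω a x)
    (A : FockE H J →L[ℂ] FockE H J) (hA : IsCre ω η A) (ζ : FockE H J) (w : List J) :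
    ⟪ω, esnd (x (A ζ)) w⟫ = ⟪ω, a ω⟫ * ⟪ω, esnd (A ζ) w⟫ := by
  have h0 : ⟪fockOmega J ω, A ζ⟫ = 0 := by
    rw [omega_inner, (hA ζ).2.1, inner_zero_right]
  have hω1 : ⟪ω, ω⟫ = 1 := by
    rw [inner_self_eq_norm_sq_to_K, hω]; simp
  rw [(hx (A ζ)).2 w, h0, zero_smul, sub_zero]
  cases w with
  | nil => rw [(hA ζ).2.1]; simp
  | cons j w =>
    rw [(hA ζ).2.2 j w]
    simp only [map_smul, inner_smul_right, hω1]
    ring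

end Helpers

/-- Lemma 3 of the paper: for unit vectors `η₁, η₂` and `x = π(a)`,
`A*_{η₁} x A*_{η₂} = ψ(x)·A*_{η₁} A*_{η₂}` and
`A_{η₁,n} x A*_{η₂} = ψ(x)·A_{η₁,n} A*_{η₂}` for every `n ≥ 0`, where
`ψ(x) = ⟨a ω, ω⟩`. -/
theorem embed_between_creation_annihilation
    {H : Type*} [NormedAddCommGroup H] [InnerProductSpace ℂ H]
    {J : Type*} [DecidableEq J] (ω : H) (hω : ‖ω‖ = 1)
    (η₁ η₂ : lp (fun _ : J => ℂ) 2) (hη₁ : ‖η₁‖ = 1) (hη₂ : ‖η₂‖ = 1)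
    (a : H →L[ℂ] H) (x : FockE H J →L[ℂ] FockE H J) (hx : IsEmbed ω a x)
    (A₁ A₂ : FockE H J →L[ℂ] FockE H J) (hA₁ : IsCre ω η₁ A₁) (hA₂ : IsCre ω η₂ A₂) :
    A₁ ∘L x ∘L A₂ = ⟪ω, a ω⟫ • (A₁ ∘L A₂) ∧
    ∀ (n : ℕ) (T : FockE H J →L[ℂ] FockE H J), IsAnn ω η₁ n T →
      T ∘L x ∘L A₂ = ⟪ω, a ω⟫ • (T ∘L A₂) := by
  have key := embed_cre ω hω η₂ a x hx A₂ hA₂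
  refine ⟨?_, ?_⟩
  · ext1 ζ
    change A₁ (x (A₂ ζ)) = ⟪ω, a ω⟫ • A₁ (A₂ ζ)
    apply fock_ext
    · rw [efst_smul, (hA₁ _).1, (hA₁ _).1, smul_zero]
    · intro w
      rw [esnd_smul]
      cases w with
      | nil => rw [(hA₁ _).2.1, (hA₁ _).2.1, smul_zero]
      | cons j w =>
        rw [(hA₁ _).2.2, (hA₁ _).2.2, key]
        simp only [smul_smul]
        congr 1
        ring
  · rintro n T ⟨ξ, ⟨hξ1, hξ2⟩, hT⟩
    ext1 ζ
    change T (x (A₂ ζ)) = ⟪ω, a ω⟫ • T (A₂ ζ)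
    rw [hT, hT, smul_smul]
    congr 1
    rw [fock_inner, fock_inner, hξ1, inner_zero_left, inner_zero_left, zero_add, zero_add,
      ← tsum_mul_left]
    congr 1
    funext w
    rw [hξ2 w]
    split_ifs
    · rw [inner_smul_left, inner_smul_left, key]
      ring
    · simp
end
end

section
/- In the c-free Fock model, let η₁, η₂ ∈ ℓ²(J) be orthogonal unit vectors (Σ_j η₁(j)·conj(η₂(j)) = 0). Then for all n ≥ 0 and p ≥ 0, A_{η₁,n} ∘ (A*_{η₁})^p ∘ A*_{η₂} = 0. -/
noncomputable section
open scoped ComplexInnerProductSpace ENNReal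
open PowerSeries

theorem fockE_inner {H : Type*} [NormedAddCommGroup H] [InnerProductSpace ℂ H]
    {J : Type*} (x y : FockE H J) :
    ⟪x, y⟫ = ⟪efst x, efst y⟫ + ∑' w, ⟪esnd x w, esnd y w⟫ := by
  rw [WithLp.prod_inner_apply, lp.inner_eq_tsum]
  rfl

theorem fockE_summable {H : Type*} [NormedAddCommGroup H] [InnerProductSpace ℂ H]
    {J : Type*} (x y : FockE H J) :
    Summable fun w => ⟪esnd x w, esnd y w⟫ :=
  lp.summable_inner _ _

theorem fockE_ext {H : Type*} [NormedAddCommGroup H] [InnerProductSpace ℂ H]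
    {J : Type*} {x y : FockE H J} (h1 : efst x = efst y) (h2 : ∀ w, esnd x w = esnd y w) :
    x = y := by
  apply (WithLp.equiv 2 _).injective
  exact Prod.ext h1 (lp.ext (funext h2))

theorem efst_omega {H : Type*} [NormedAddCommGroup H] [InnerProductSpace ℂ H]
    {J : Type*} [DecidableEq J] (ω : H) : efst (fockOmega J ω) = 0 := rfl

theorem esnd_omega {H : Type*} [NormedAddCommGroup H] [InnerProductSpace ℂ H]
    {J : Type*} [DecidableEq J] (ω : H) (w : List J) :
    esnd (fockOmega J ω) w = if w = [] then ω else 0 := by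
  change (lp.single 2 ([] : List J) ω : lp (fun _ : List J => H) 2) w = _
  rw [lp.single_apply]
  by_cases h : w = []
  · subst h; simp
  · simp [h]

theorem cre_inner {H : Type*} [NormedAddCommGroup H] [InnerProductSpace ℂ H]
    {J : Type*} [DecidableEq J] (ω : H) (hω : ‖ω‖ = 1)
    (η η' : lp (fun _ : J => ℂ) 2)
    (C C' : FockE H J →L[ℂ] FockE H J) (hC : IsCre ω η C) (hC' : IsCre ω η' C')
    (x y : FockE H J) :
    ⟪C x, C' y⟫ = (∑' j, starRingEnd ℂ (η j) * η' j) *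
      ∑' w, (⟪esnd x w, ω⟫ * ⟪ω, esnd y w⟫) := by
  have hinj : Function.Injective (fun q : J × List J => q.1 :: q.2) := by
    rintro ⟨a, b⟩ ⟨c, d⟩ h
    simpa using h
  have hs := (fockE_summable (C x) (C' y)).comp_injective hinj
  have hval : ∀ j w, ⟪esnd (C x) (j :: w), esnd (C' y) (j :: w)⟫ =
      (starRingEnd ℂ (η j) * η' j) * (⟪esnd x w, ω⟫ * ⟪ω, esnd y w⟫) := by
    intro j w
    rw [(hC x).2.2, (hC' y).2.2]
    simp only [inner_smul_left, inner_smul_right, inner_conj_symm,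
      inner_self_eq_norm_sq_to_K, hω]
    push_cast
    ring
  rw [fockE_inner, (hC x).1, inner_zero_left, zero_add, ← hinj.tsum_eq]
  · refine hs.tsum_prod.trans ?_
    simp only [Function.comp_def, hval, tsum_mul_left, tsum_mul_right]
  · intro w hw
    cases w with
    | nil => simp [(hC x).2.1] at hw
    | cons j w => exact ⟨(j, w), rfl⟩

theorem cre_range {H : Type*} [NormedAddCommGroup H] [InnerProductSpace ℂ H]
    {J : Type*} [DecidableEq J] (ω : H) (hω : ‖ω‖ = 1)
    (η : lp (fun _ : J => ℂ) 2)
    (C : FockE H J →L[ℂ] FockE H J) (hC : IsCre ω η C) (y : FockE H J) (w : List J) :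
    ⟪ω, esnd (C y) w⟫ • ω = esnd (C y) w := by
  cases w with
  | nil => simp [(hC y).2.1]
  | cons j w =>
    rw [(hC y).2.2]
    simp [inner_smul_right, inner_self_eq_norm_sq_to_K, hω, smul_smul]

theorem xi_eq {H : Type*} [NormedAddCommGroup H] [InnerProductSpace ℂ H]
    {J : Type*} [DecidableEq J] (ω : H) (hω : ‖ω‖ = 1)
    (η : lp (fun _ : J => ℂ) 2)
    (C : FockE H J →L[ℂ] FockE H J) (hC : IsCre ω η C) (n : ℕ) (ξ : FockE H J)
    (hξ : IsXi ω η n ξ) : ξ = (C ^ n) (fockOmega J ω) := by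
  have key : ∀ n, IsXi ω η n ((C ^ n) (fockOmega J ω)) := by
    intro n
    induction n with
    | zero =>
      refine ⟨efst_omega ω, fun w => ?_⟩
      have := esnd_omega ω w
      cases w with
      | nil => simpa using this
      | cons j w => simpa using this
    | succ n ih =>
      rw [pow_succ']
      refine ⟨(hC _).1, fun w => ?_⟩
      cases w with
      | nil => simpa using (hC _).2.1
      | cons j w =>
        refine ((hC ((C ^ n) (fockOmega J ω))).2.2 j w).trans ?_
        rw [ih.2 w]
        by_cases h : w.length = n
        · simp [h, inner_smul_right, inner_self_eq_norm_sq_to_K, hω, smul_smul]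
        · simp [h]
  exact fockE_ext (hξ.1.trans (key n).1.symm) fun w => (hξ.2 w).trans ((key n).2 w).symm

theorem inner_pow_zero
    {H : Type*} [NormedAddCommGroup H] [InnerProductSpace ℂ H]
    {J : Type*} [DecidableEq J] (ω : H) (hω : ‖ω‖ = 1)
    (η₁ η₂ : lp (fun _ : J => ℂ) 2)
    (horth : ∑' j : J, η₁ j * starRingEnd ℂ (η₂ j) = 0)
    (C₁ C₂ : FockE H J →L[ℂ] FockE H J) (hC₁ : IsCre ω η₁ C₁) (hC₂ : IsCre ω η₂ C₂)
    (n p : ℕ) (ζ : FockE H J) :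
    ⟪(C₁ ^ n) (fockOmega J ω), (C₁ ^ p) (C₂ ζ)⟫ = 0 := by
  have horth' : ∑' j : J, starRingEnd ℂ (η₁ j) * η₂ j = 0 := by
    have h := congrArg (starRingEnd ℂ) horth
    rw [Complex.conj_tsum] at h
    simpa using h
  have hran : ∀ p w, ⟪ω, esnd ((C₁ ^ p) (C₂ ζ)) w⟫ • ω = esnd ((C₁ ^ p) (C₂ ζ)) w := by
    intro p w
    cases p with
    | zero => exact cre_range ω hω η₂ C₂ hC₂ ζ w
    | succ p => rw [pow_succ']; exact cre_range ω hω η₁ C₁ hC₁ _ w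
  have hnil : ∀ p, esnd ((C₁ ^ p) (C₂ ζ)) [] = 0 := by
    intro p
    cases p with
    | zero => exact (hC₂ ζ).2.1
    | succ p => rw [pow_succ']; exact (hC₁ _).2.1
  have hfst : ∀ p, efst ((C₁ ^ p) (C₂ ζ)) = 0 := by
    intro p
    cases p with
    | zero => exact (hC₂ ζ).1
    | succ p => rw [pow_succ']; exact (hC₁ _).1
  induction n generalizing p with
  | zero =>
    rw [fockE_inner, hfst, inner_zero_right, zero_add]
    refine (tsum_congr fun w => ?_).trans tsum_zero
    cases w with
    | nil => rw [hnil, inner_zero_right]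
    | cons j w =>
      have : esnd ((C₁ ^ 0) (fockOmega J ω)) (j :: w) = 0 := by
        simpa using esnd_omega ω (j :: w)
      rw [this, inner_zero_left]
  | succ n ih =>
    cases p with
    | zero =>
      rw [pow_succ']
      refine (cre_inner ω hω η₁ η₂ C₁ C₂ hC₁ hC₂ _ ζ).trans ?_
      rw [horth', zero_mul]
    | succ p =>
      rw [pow_succ', pow_succ']
      refine (cre_inner ω hω η₁ η₁ C₁ C₁ hC₁ hC₁ _ _).trans ?_
      have h := ih p
      rw [fockE_inner, hfst, inner_zero_right, zero_add] at h
      convert mul_zero _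
      rw [← h]
      refine tsum_congr fun w => ?_
      conv_rhs => rw [← hran p w]
      rw [inner_smul_right, mul_comm]
      rfl

/-- Remark 2 of the paper: if `η₁ ⊥ η₂`, then `A_{η₁,n} (A*_{η₁})^p A*_{η₂} = 0`
for all `n, p ≥ 0`. -/
theorem annihilation_creation_orthogonal
    {H : Type*} [NormedAddCommGroup H] [InnerProductSpace ℂ H]
    {J : Type*} [DecidableEq J] (ω : H) (hω : ‖ω‖ = 1)
    (η₁ η₂ : lp (fun _ : J => ℂ) 2) (hη₁ : ‖η₁‖ = 1) (hη₂ : ‖η₂‖ = 1)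
    (horth : ∑' j : J, η₁ j * starRingEnd ℂ (η₂ j) = 0)
    (C₁ C₂ : FockE H J →L[ℂ] FockE H J) (hC₁ : IsCre ω η₁ C₁) (hC₂ : IsCre ω η₂ C₂) :
    ∀ (n p : ℕ) (T : FockE H J →L[ℂ] FockE H J), IsAnn ω η₁ n T →
      T ∘L (C₁ ^ p) ∘L C₂ = 0 := by
  intro n p T hT
  obtain ⟨ξ, hξ, hT⟩ := hT
  have hξ' := xi_eq ω hω η₁ C₁ hC₁ n ξ hξ
  ext1 ζ
  have h := inner_pow_zero ω hω η₁ η₂ horth C₁ C₂ hC₁ hC₂ n p ζ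
  change T ((C₁ ^ p) (C₂ ζ)) = 0
  rw [hT, hξ', h, zero_smul]
end
end

section
/- In the full Fock space model, let e₁, e₂ ∈ ℓ²(ι) be nonzero orthogonal vectors. Then the unital subalgebras 𝒜(e₁) and 𝒜(e₂) of the bounded operators on 𝔽(ι) are free with respect to the vacuum state φ(T) = ⟨TΩ, Ω⟩. -/
noncomputable section
open scoped ComplexInnerProductSpace ENNReal
open PowerSeries

/-- Unital subalgebras `A₁, A₂` of a unital associative `ℂ`-algebra are *free* with
respect to a functional `χ` with `χ 1 = 1`: `χ` vanishes on alternating products of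
`χ`-centered elements. -/
def IsFreePair {A : Type*} [Ring A] [Algebra ℂ A] (χ : A → ℂ)
    (A₁ A₂ : Subalgebra ℂ A) : Prop :=
  ∀ (n : ℕ) (ε : Fin n → Fin 2) (x : Fin n → A), 0 < n →
    (∀ j, x j ∈ (if ε j = 0 then A₁ else A₂)) →
    (∀ (j : ℕ) (h : j + 1 < n), ε ⟨j, Nat.lt_of_succ_lt h⟩ ≠ ε ⟨j + 1, h⟩) →
    (∀ j, χ (x j) = 0) →
    χ (List.ofFn x).prod = 0

/-- Unital subalgebras `A₁, A₂` are *c-free* with respect to the pair `(φ, ψ)`: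
they are free with respect to `ψ`, and `φ` is multiplicative on alternating products
of `ψ`-centered elements. -/
def IsCFreePair {A : Type*} [Ring A] [Algebra ℂ A] (φ ψ : A → ℂ)
    (A₁ A₂ : Subalgebra ℂ A) : Prop :=
  IsFreePair ψ A₁ A₂ ∧
  ∀ (n : ℕ) (ε : Fin n → Fin 2) (x : Fin n → A), 0 < n →
    (∀ j, x j ∈ (if ε j = 0 then A₁ else A₂)) →
    (∀ (j : ℕ) (h : j + 1 < n), ε ⟨j, Nat.lt_of_succ_lt h⟩ ≠ ε ⟨j + 1, h⟩) →
    (∀ j, ψ (x j) = 0) →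
    φ (List.ofFn x).prod = ∏ j, φ (x j)

/-- The full Fock space `𝔽(ι) = ℓ²(List ι)` over the index type `ι`. -/
abbrev FFock (ι : Type*) : Type _ := lp (fun _ : List ι => ℂ) 2

/-- The vacuum vector `δ_[]` of the full Fock space. -/
def fockVac (ι : Type*) [DecidableEq ι] : FFock ι := lp.single 2 ([] : List ι) (1 : ℂ)

/-- `C` is the creation operator `a*_e`: `(a*_e F) [] = 0` and
`(a*_e F) (j :: w) = e j · F w`. -/
def IsCreF {ι : Type*} (e : lp (fun _ : ι => ℂ) 2) (C : FFock ι →L[ℂ] FFock ι) : Prop :=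
  ∀ F : FFock ι, (C F) ([] : List ι) = 0 ∧
    ∀ (j : ι) (w : List ι), (C F) (j :: w) = e j * F w

/-- The vacuum state `φ(T) = ⟨TΩ, Ω⟩` on bounded operators on the full Fock space. -/
def vacState (ι : Type*) [DecidableEq ι] (T : FFock ι →L[ℂ] FFock ι) : ℂ :=
  ⟪fockVac ι, T (fockVac ι)⟫

section FreeHelpers
variable {ι : Type*} [DecidableEq ι]

lemma vacState_apply (T : FFock ι →L[ℂ] FFock ι) : vacState ι T = (T (fockVac ι)) [] := by
  unfold vacState
  conv_lhs => arg 2; rw [fockVac]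
  rw [lp.inner_single_left]
  simp

lemma adj_apply {e : lp (fun _ : ι => ℂ) 2} {c : FFock ι →L[ℂ] FFock ι} (hc : IsCreF e c)
    (G : FFock ι) (w : List ι) :
    (ContinuousLinearMap.adjoint c G) w = ∑' j, G (j :: w) * starRingEnd ℂ (e j) := by
  have h := lp.inner_single_left (𝕜 := ℂ) (G := fun _ : List ι => ℂ) w (1 : ℂ)
    (ContinuousLinearMap.adjoint c G)
  rw [ContinuousLinearMap.adjoint_inner_right, lp.inner_eq_tsum] at h
  have h1 : (ContinuousLinearMap.adjoint c G) w
      = ⟪(1 : ℂ), (ContinuousLinearMap.adjoint c G) w⟫ := by simp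
  rw [h1, ← h]
  have hinj : Function.Injective (fun j : ι => j :: w) := fun a b h => by simpa using h
  rw [← hinj.tsum_eq]
  · refine tsum_congr fun j => ?_
    rw [(hc _).2]
    simp
  · intro u hu
    rw [Function.mem_support] at hu
    cases u with
    | nil => exact absurd (by rw [(hc _).1]; simp) hu
    | cons j v =>
      by_cases hv : v = w
      · exact ⟨j, by simp [hv]⟩
      · refine absurd ?_ hu
        rw [(hc _).2, lp.single_apply_ne _ _ _ hv]
        simp

lemma adj_mul {e f : lp (fun _ : ι => ℂ) 2} {c d : FFock ι →L[ℂ] FFock ι} (hc : IsCreF e c)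
    (hd : IsCreF f d) (v : FFock ι) :
    ContinuousLinearMap.adjoint c (d v) = ⟪e, f⟫ • v := by
  ext w
  rw [adj_apply hc, lp.coeFn_smul, Pi.smul_apply, smul_eq_mul, lp.inner_eq_tsum, ← tsum_mul_right]
  refine tsum_congr fun j => ?_
  rw [(hd _).2]
  simp
  ring

lemma adj_vac {e : lp (fun _ : ι => ℂ) 2} {c : FFock ι →L[ℂ] FFock ι} (hc : IsCreF e c) :
    ContinuousLinearMap.adjoint c (fockVac ι) = 0 := by
  ext w
  rw [adj_apply hc, lp.coeFn_zero, Pi.zero_apply]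
  convert tsum_zero with j
  rw [fockVac, lp.single_apply_ne _ _ _ (by simp)]
  simp

lemma mem_span_words {A : Type*} [Ring A] [Algebra ℂ A] (c a : A) (k : ℂ)
    (h : a * c = k • (1 : A)) {x : A} (hx : x ∈ Algebra.adjoin ℂ {c, a}) :
    x ∈ Submodule.span ℂ (Set.range fun p : ℕ × ℕ => c ^ p.1 * a ^ p.2) := by
  set S := Submodule.span ℂ (Set.range fun p : ℕ × ℕ => c ^ p.1 * a ^ p.2) with hS
  have hmem : ∀ m n : ℕ, c ^ m * a ^ n ∈ S := fun m n => Submodule.subset_span ⟨(m, n), rfl⟩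
  have key : ∀ s ∈ S, x * s ∈ S := by
    induction hx using Algebra.adjoin_induction with
    | mem y hy =>
      intro s hs
      induction hs using Submodule.span_induction with
      | zero => simp
      | add p q _ _ hp hq => rw [mul_add]; exact S.add_mem hp hq
      | smul r p _ hp => rw [mul_smul_comm]; exact S.smul_mem r hp
      | mem s hs =>
        obtain ⟨⟨m, n⟩, rfl⟩ := hs
        rcases hy with rfl | rfl
        · have := hmem (m + 1) n
          rwa [pow_succ', mul_assoc] at this
        · cases m with
          | zero => simpa [pow_succ'] using hmem 0 (n + 1)
          | succ m =>
            have : y * (c ^ (m + 1) * y ^ n) = k • (c ^ m * y ^ n) := by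
              rw [pow_succ', ← mul_assoc, ← mul_assoc, h]
              simp
            simp only [this]
            exact S.smul_mem k (hmem m n)
    | algebraMap r => intro s hs; rw [← Algebra.smul_def]; exact S.smul_mem r hs
    | add p q _ _ hp hq => intro s hs; rw [add_mul]; exact S.add_mem (hp s hs) (hq s hs)
    | mul p q _ _ hp hq => intro s hs; rw [mul_assoc]; exact hp _ (hq s hs)
  simpa using key 1 (by simpa using hmem 0 0)

lemma exists_decomp {A : Type*} [Ring A] [Algebra ℂ A] (c a : A) (k : ℂ)
    (h : a * c = k • (1 : A)) {x : A} (hx : x ∈ Algebra.adjoin ℂ {c, a}) :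
    ∃ (l : ℂ) (y z : A), x = l • (1 : A) + c * y + z * a := by
  have := mem_span_words c a k h hx
  clear hx
  induction this using Submodule.span_induction with
  | zero => exact ⟨0, 0, 0, by simp⟩
  | add p q _ _ hp hq =>
    obtain ⟨l, y, z, rfl⟩ := hp
    obtain ⟨l', y', z', rfl⟩ := hq
    exact ⟨l + l', y + y', z + z', by rw [add_smul, mul_add, add_mul]; abel⟩
  | smul r p _ hp =>
    obtain ⟨l, y, z, rfl⟩ := hp
    exact ⟨r * l, r • y, r • z, by simp [smul_add, mul_smul]⟩
  | mem s hs =>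
    obtain ⟨⟨m, n⟩, rfl⟩ := hs
    cases m with
    | succ m => exact ⟨0, c ^ m * a ^ n, 0, by simp [pow_succ', mul_assoc]⟩
    | zero =>
      cases n with
      | zero => exact ⟨1, 0, 0, by simp⟩
      | succ n => exact ⟨0, 0, a ^ n, by simp [pow_succ]⟩

/-- Centered elements map the kernel of the annihilator into the range of the creator. -/
lemma centered_range {e : lp (fun _ : ι => ℂ) 2} {c : FFock ι →L[ℂ] FFock ι} (hc : IsCreF e c)
    {x : FFock ι →L[ℂ] FFock ι}
    (hx : x ∈ Algebra.adjoin ℂ {c, ContinuousLinearMap.adjoint c}) (h0 : vacState ι x = 0)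
    (v : FFock ι) (hv : ContinuousLinearMap.adjoint c v = 0) : ∃ w, x v = c w := by
  obtain ⟨l, y, z, rfl⟩ := exists_decomp c (ContinuousLinearMap.adjoint c) ⟪e, e⟫
    (by ext1 v; exact adj_mul hc hc v) hx
  have hl : l = 0 := by
    rw [vacState_apply] at h0
    have hv1 : (fockVac ι) [] = 1 := by simp [fockVac]
    have h2 : (l • (1 : FFock ι →L[ℂ] FFock ι) + c * y + z * ContinuousLinearMap.adjoint c)
        (fockVac ι) = l • fockVac ι + c (y (fockVac ι)) := by
      simp [adj_vac hc]
    rw [h2, lp.coeFn_add, Pi.add_apply, (hc _).1, lp.coeFn_smul, Pi.smul_apply, hv1] at h0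
    simpa using h0
  subst hl
  exact ⟨y v, by simp [hv]⟩

lemma free_aux (e : Fin 2 → lp (fun _ : ι => ℂ) 2) (c : Fin 2 → FFock ι →L[ℂ] FFock ι)
    (hc : ∀ i, IsCreF (e i) (c i)) (ho : ∀ i j, i ≠ j → ⟪e i, e j⟫ = 0) (n : ℕ) :
    ∀ (ε : Fin (n + 1) → Fin 2) (x : Fin (n + 1) → FFock ι →L[ℂ] FFock ι),
    (∀ j, x j ∈ Algebra.adjoin ℂ {c (ε j), ContinuousLinearMap.adjoint (c (ε j))}) →
    (∀ (j : ℕ) (h : j + 1 < n + 1), ε ⟨j, Nat.lt_of_succ_lt h⟩ ≠ ε ⟨j + 1, h⟩) →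
    (∀ j, vacState ι (x j) = 0) →
    ∃ w, (List.ofFn x).prod (fockVac ι) = c (ε 0) w := by
  induction n with
  | zero =>
    intro ε x hx _ h0
    obtain ⟨w, hw⟩ := centered_range (hc _) (hx 0) (h0 0) _ (adj_vac (hc _))
    exact ⟨w, by simpa using hw⟩
  | succ n ih =>
    intro ε x hx hε h0
    obtain ⟨w, hw⟩ := ih (fun j => ε j.succ) (fun j => x j.succ) (fun j => hx _)
      (fun j h => hε (j + 1) (by omega)) (fun j => h0 _)
    obtain ⟨w', hw'⟩ := centered_range (hc _) (hx 0) (h0 0) (c (ε (Fin.succ 0)) w) (by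
      rw [adj_mul (hc _) (hc _), ho (ε 0) (ε (Fin.succ 0)) (hε 0 (by omega)), zero_smul])
    refine ⟨w', ?_⟩
    rw [List.ofFn_succ, List.prod_cons, ContinuousLinearMap.mul_apply, hw, hw']

end FreeHelpers

/-- Theorem 2.1(1) of the paper (after Voiculescu): for nonzero orthogonal vectors
`e₁ ⊥ e₂`, the algebras `𝒜(e₁)` and `𝒜(e₂)` generated by the corresponding creation
and annihilation operators are free with respect to the vacuum state. -/
theorem creation_annihilation_algebras_free
    {ι : Type*} [DecidableEq ι] (e₁ e₂ : lp (fun _ : ι => ℂ) 2)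
    (he₁ : e₁ ≠ 0) (he₂ : e₂ ≠ 0) (horth : ⟪e₁, e₂⟫ = 0)
    (c₁ c₂ : FFock ι →L[ℂ] FFock ι) (hc₁ : IsCreF e₁ c₁) (hc₂ : IsCreF e₂ c₂) :
    IsFreePair (vacState ι)
      (Algebra.adjoin ℂ {c₁, ContinuousLinearMap.adjoint c₁})
      (Algebra.adjoin ℂ {c₂, ContinuousLinearMap.adjoint c₂}) := by
  intro n ε x hn hx hε h0
  obtain ⟨n, rfl⟩ : ∃ m, n = m + 1 := ⟨n - 1, by omega⟩
  have hc : ∀ i, IsCreF (![e₁, e₂] i) (![c₁, c₂] i) := by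
    intro i; fin_cases i
    · exact hc₁
    · exact hc₂
  have ho : ∀ i j, i ≠ j → ⟪![e₁, e₂] i, ![e₁, e₂] j⟫ = 0 := by
    intro i j hij
    fin_cases i <;> fin_cases j
    · exact absurd rfl hij
    · exact horth
    · exact inner_eq_zero_symm.1 horth
    · exact absurd rfl hij
  obtain ⟨w, hw⟩ := free_aux _ _ hc ho n ε x (by
    intro j
    have := hx j
    generalize ε j = i at this ⊢
    fin_cases i
    · simpa using this
    · simpa using this) hε h0
  rw [vacState_apply, hw, (hc _ _).1]
end
end

section
/- Let b, A, B be bounded operators on E and (s_q)_{q≥1} complex scalars such that: (i) bΩ = 0, and ⟨bζ, Ω⟩ = 0 and ⟨Aζ, Ω⟩ = 0 for every ζ ∈ E; (ii) Bζ ∈ ℂΩ for every ζ ∈ E; (iii) A ∘ b^q ∘ A = s_q·A² and B ∘ b^q ∘ A = s_q·(B ∘ A) for every q ≥ 1. Set s₀ := 1, f_p := φ(B ∘ A^p) for p ≥ 0, and α := b + A + B. Then for every n ≥ 1: φ(αⁿ) = Σ over all integers p ≥ 0 and all tuples (q₁, …, q_p) of nonnegative integers with 1 + p + q₁ + ⋯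 + q_p ≤ n of φ(α^{n−1−(p+q₁+⋯+q_p)}) · f_p · s_{q₁}⋯s_{q_p}, where φ(α⁰) := 1. -/
noncomputable section
open scoped ComplexInnerProductSpace ENNReal
open PowerSeries

/-- the coefficient of `T A^p Ω` in `T (b+A)^m Ω` -/
def recCoeff (s : ℕ → ℂ) (M p m : ℕ) : ℂ :=
  ∑ q : Fin p → Fin M, if p + ∑ i, (q i : ℕ) = m then ∏ i, s (q i : ℕ) else 0

lemma recCoeff_zero (s : ℕ → ℂ) (M m : ℕ) :
    recCoeff s M 0 m = if m = 0 then 1 else 0 := by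
  simp [recCoeff, eq_comm]

lemma recCoeff_succ (s : ℕ → ℂ) (M p m : ℕ) (hm : m ≤ M) :
    recCoeff s M (p + 1) m =
      ∑ j ∈ Finset.range m, s j * recCoeff s M p (m - 1 - j) := by
  have h1 : recCoeff s M (p + 1) m =
      ∑ j : Fin M, if (j : ℕ) < m then s j * recCoeff s M p (m - 1 - j) else 0 := by
    unfold recCoeff
    rw [← (Fin.consEquiv (fun _ : Fin (p + 1) => Fin M)).sum_comp, Fintype.sum_prod_type]
    refine Finset.sum_congr rfl fun j _ => ?_
    simp only [Fin.consEquiv_apply, Fin.sum_univ_succ, Fin.prod_univ_succ, Fin.cons_zero,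
      Fin.cons_succ]
    split_ifs with hj
    · rw [Finset.mul_sum]
      refine Finset.sum_congr rfl fun q _ => ?_
      rw [mul_ite, mul_zero]
      refine if_congr ?_ rfl rfl
      omega
    · refine Finset.sum_eq_zero fun q _ => if_neg ?_
      omega
  rw [h1, Fin.sum_univ_eq_sum_range
    (fun j => if j < m then s j * recCoeff s M p (m - 1 - j) else 0) M]
  symm
  rw [← Finset.sum_filter]
  refine Finset.sum_congr ?_ fun _ _ => rfl
  ext j
  simp only [Finset.mem_range, Finset.mem_filter]
  omega

lemma pow_expand_left {R : Type*} [Ring R] (b A : R) (m : ℕ) :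
    (b + A) ^ m = b ^ m + ∑ j ∈ Finset.range m, b ^ j * A * (b + A) ^ (m - 1 - j) := by
  induction m with
  | zero => simp
  | succ m ih =>
    rw [Finset.sum_range_succ']
    have h : ∑ k ∈ Finset.range m, b ^ (k + 1) * A * (b + A) ^ (m + 1 - 1 - (k + 1)) =
        b * ∑ j ∈ Finset.range m, b ^ j * A * (b + A) ^ (m - 1 - j) := by
      rw [Finset.mul_sum]
      refine Finset.sum_congr rfl fun k _ => ?_
      rw [pow_succ', show m + 1 - 1 - (k + 1) = m - 1 - k by omega]
      simp only [mul_assoc]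
    rw [h, pow_succ', add_mul, pow_succ' b]
    conv_lhs => rw [ih, mul_add, ← ih]
    simp [add_assoc]

lemma pow_expand_right {R : Type*} [Ring R] (C B : R) (n : ℕ) :
    (C + B) ^ n = C ^ n + ∑ m ∈ Finset.range n, (C + B) ^ (n - 1 - m) * B * C ^ m := by
  induction n with
  | zero => simp
  | succ n ih =>
    rw [Finset.sum_range_succ']
    have h : ∑ k ∈ Finset.range n, (C + B) ^ (n + 1 - 1 - (k + 1)) * B * C ^ (k + 1) =
        (∑ m ∈ Finset.range n, (C + B) ^ (n - 1 - m) * B * C ^ m) * C := by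
      rw [Finset.sum_mul]
      refine Finset.sum_congr rfl fun k _ => ?_
      rw [pow_succ, show n + 1 - 1 - (k + 1) = n - 1 - k by omega]
      simp only [mul_assoc]
    rw [h, pow_succ, mul_add, pow_succ C]
    conv_lhs => rw [ih, add_mul, ← ih]
    simp [add_assoc]

lemma clm_mul_apply {E : Type*} [NormedAddCommGroup E] [InnerProductSpace ℂ E]
    (S T : E →L[ℂ] E) (x : E) : (S * T) x = S (T x) := rfl

lemma expand_vec {E : Type*} [NormedAddCommGroup E] [InnerProductSpace ℂ E]
    (Ω : E) (b A : E →L[ℂ] E) (s : ℕ → ℂ) (hbΩ : b Ω = 0) (M : ℕ)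
    (hAbA : ∀ (q : ℕ) (x : E), A ((b ^ q) (A x)) = s q • A (A x)) :
    ∀ m : ℕ, m ≤ M → ∀ N : ℕ, m < N → ∀ T : E →L[ℂ] E,
      (∀ (q : ℕ) (x : E), T ((b ^ q) (A x)) = s q • T (A x)) →
      T (((b + A) ^ m) Ω) = ∑ p ∈ Finset.range N, recCoeff s M p m • T ((A ^ p) Ω) := by
  intro m
  induction m using Nat.strong_induction_on with
  | _ m ih =>
    intro hm N hN T hT
    obtain ⟨N, rfl⟩ : ∃ N', N = N' + 1 := ⟨N - 1, by omega⟩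
    have hb : T ((b ^ m) Ω) = (if m = 0 then (1 : ℂ) else 0) • T Ω := by
      cases m with
      | zero => simp
      | succ k => simp [pow_succ, hbΩ]
    have hj : ∀ j ∈ Finset.range m, T ((b ^ j * A * (b + A) ^ (m - 1 - j)) Ω) =
        ∑ p ∈ Finset.range N, (s j * recCoeff s M p (m - 1 - j)) • T ((A ^ (p + 1)) Ω) := by
      intro j hj
      have hj' := Finset.mem_range.1 hj
      have h1 := ih (m - 1 - j) (by omega) (by omega) N (by omega) A hAbA
      simp only [clm_mul_apply]
      rw [hT, h1, map_sum, Finset.smul_sum]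
      refine Finset.sum_congr rfl fun p _ => ?_
      rw [map_smul, smul_smul, pow_succ', clm_mul_apply]
    rw [pow_expand_left, ContinuousLinearMap.add_apply, ContinuousLinearMap.sum_apply, map_add,
      map_sum, Finset.sum_congr rfl hj, hb, Finset.sum_range_succ', recCoeff_zero,
      Finset.sum_comm, add_comm]
    congr 1
    refine Finset.sum_congr rfl fun p _ => ?_
    rw [recCoeff_succ s M p m hm, Finset.sum_smul]

/-- The key recursion in the proof of Theorem 3.1 of the paper: if `(b, A, B)` satisfies
(i) `bΩ = 0` and `b, A` have ranges orthogonal to `Ω`, (ii) `B` has range in `ℂΩ`, and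
(iii) `A b^q A = s_q A²`, `B b^q A = s_q B A` for `q ≥ 1`, then with `f_p = φ(B A^p)`
and `α = b + A + B`,
`φ(αⁿ) = Σ_{p ≥ 0, q₁,…,q_p ≥ 0, 1+p+q₁+⋯+q_p ≤ n} φ(α^{n-1-(p+q₁+⋯+q_p)})·f_p·s_{q₁}⋯s_{q_p}`
for every `n ≥ 1`. -/
theorem moment_recursion_of_triple
    {E : Type*} [NormedAddCommGroup E] [InnerProductSpace ℂ E]
    (Ω : E) (hΩ : ‖Ω‖ = 1) (b A B : E →L[ℂ] E) (s : ℕ → ℂ) (hs0 : s 0 = 1)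
    (hbΩ : b Ω = 0)
    (hb : ∀ ζ : E, ⟪Ω, b ζ⟫ = 0) (hA : ∀ ζ : E, ⟪Ω, A ζ⟫ = 0)
    (hB : ∀ ζ : E, ∃ c : ℂ, B ζ = c • Ω)
    (hAbA : ∀ q : ℕ, 1 ≤ q → A ∘L (b ^ q) ∘L A = s q • (A ∘L A))
    (hBbA : ∀ q : ℕ, 1 ≤ q → B ∘L (b ^ q) ∘L A = s q • (B ∘L A)) :
    ∀ n : ℕ, 1 ≤ n →
      ⟪Ω, ((b + A + B) ^ n) Ω⟫ =
        ∑ p ∈ Finset.range n, ∑ q : Fin p → Fin n,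
          if 1 + p + ∑ i, (q i : ℕ) ≤ n then
            ⟪Ω, ((b + A + B) ^ (n - 1 - (p + ∑ i, (q i : ℕ)))) Ω⟫ *
              ⟪Ω, (B ∘L (A ^ p)) Ω⟫ * ∏ i, s (q i : ℕ)
          else 0 := by
  intro n hn
  have hA' : ∀ (q : ℕ) (x : E), A ((b ^ q) (A x)) = s q • A (A x) := by
    intro q x
    rcases Nat.eq_zero_or_pos q with rfl | hq
    · simp [hs0]
    · simpa using congrArg (fun T : E →L[ℂ] E => T x) (hAbA q hq)
  have hB' : ∀ (q : ℕ) (x : E), B ((b ^ q) (A x)) = s q • B (A x) := by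
    intro q x
    rcases Nat.eq_zero_or_pos q with rfl | hq
    · simp [hs0]
    · simpa using congrArg (fun T : E →L[ℂ] E => T x) (hBbA q hq)
  have hBf : ∀ p : ℕ, B ((A ^ p) Ω) = ⟪Ω, (B ∘L (A ^ p)) Ω⟫ • Ω := by
    intro p
    obtain ⟨c, hc⟩ := hB ((A ^ p) Ω)
    rw [ContinuousLinearMap.comp_apply, hc, inner_smul_right, inner_self_eq_norm_sq_to_K, hΩ]
    simp
  have h0 : ⟪Ω, ((b + A) ^ n) Ω⟫ = 0 := by
    obtain ⟨k, rfl⟩ : ∃ k, n = k + 1 := ⟨n - 1, by omega⟩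
    rw [pow_succ', clm_mul_apply, ContinuousLinearMap.add_apply, inner_add_right,
      hb, hA, add_zero]
  have hterm : ∀ m ∈ Finset.range n,
      ⟪Ω, ((b + A + B) ^ (n - 1 - m) * B * (b + A) ^ m) Ω⟫ =
      ∑ p ∈ Finset.range n, recCoeff s n p m *
        (⟪Ω, (B ∘L (A ^ p)) Ω⟫ * ⟪Ω, ((b + A + B) ^ (n - 1 - m)) Ω⟫) := by
    intro m hm
    have hm' := Finset.mem_range.1 hm
    simp only [clm_mul_apply]
    rw [expand_vec Ω b A s hbΩ n hA' m hm'.le n hm' B hB', map_sum, inner_sum]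
    refine Finset.sum_congr rfl fun p _ => ?_
    rw [hBf, map_smul, map_smul, inner_smul_right, inner_smul_right]
  rw [pow_expand_right (b + A) B n, ContinuousLinearMap.add_apply, inner_add_right, h0, zero_add,
    ContinuousLinearMap.sum_apply, inner_sum, Finset.sum_congr rfl hterm, Finset.sum_comm]
  refine Finset.sum_congr rfl fun p _ => ?_
  simp only [recCoeff, Finset.sum_mul]
  rw [Finset.sum_comm]
  refine Finset.sum_congr rfl fun q _ => ?_
  simp only [ite_mul, zero_mul]
  rw [Finset.sum_ite_eq]
  refine if_congr ?_ ?_ rfl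
  · rw [Finset.mem_range]; omega
  · ring
end
end
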